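/- Let n ≥ 1 be an integer and c > 0. Let v : ℝ² → ℝ^{n+1} be a smooth map satisfying Δv + c·v(1−|v|²) = 0 on all of ℝ² and ∫_{ℝ²} (|Dv(x)|² + (1−|v(x)|²)²) dx < ∞. Then v is constant. -/

import Mathlib

open MeasureTheory Metric Real

noncomputable section

/-- Euclidean plane. -/
abbrev E2 : Type := EuclideanSpace ℝ (Fin 2)

/-- Partial derivative in the `k`-th coordinate direction. -/
def pd {F : Type} [NormedAddCommGroup F] [NormedSpace ℝ F]
    (k : Fin 2) (f : E2 → F) (x : E2) : F :=
  fderiv ℝ f x (EuclideanSpace.single k 1)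

/-- Euclidean Laplacian, acting componentwise. -/
def lap {F : Type} [NormedAddCommGroup F] [NormedSpace ℝ F]
    (f : E2 → F) (x : E2) : F :=
  pd 0 (pd 0 f) x + pd 1 (pd 1 f) x

/-- Squared Frobenius norm of the total derivative. -/
def gradSqNorm {F : Type} [NormedAddCommGroup F] [NormedSpace ℝ F]
    (f : E2 → F) (x : E2) : ℝ :=
  ∑ k : Fin 2, ‖pd k f x‖ ^ 2

lemma pd_contDiff {F : Type} [NormedAddCommGroup F] [NormedSpace ℝ F] (k : Fin 2)
    {f : E2 → F} (hf : ContDiff ℝ (⊤ : ℕ∞) f) : ContDiff ℝ (⊤ : ℕ∞) (pd k f) := by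
  have h : ContDiff ℝ (⊤ : ℕ∞) (fderiv ℝ f) := hf.fderiv_right (by simp)
  exact h.clm_apply contDiff_const

lemma pd_continuous (k : Fin 2)
    {f : E2 → ℝ} (hf : ContDiff ℝ 1 f) : Continuous (pd k f) := by
  have h : Continuous (fderiv ℝ f) := hf.continuous_fderiv (by simp)
  exact h.clm_apply continuous_const

lemma pd_hcs (k : Fin 2) {f : E2 → ℝ} (hs : HasCompactSupport f) :
    HasCompactSupport (pd k f) := hs.fderiv_apply (𝕜 := ℝ) _

lemma pd_comm {F : Type} [NormedAddCommGroup F] [NormedSpace ℝ F]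
    {f : E2 → F} (hf : ContDiff ℝ (⊤ : ℕ∞) f) (k l : Fin 2) (x : E2) :
    pd k (pd l f) x = pd l (pd k f) x := by
  have h : ContDiff ℝ (⊤ : ℕ∞) (fderiv ℝ f) := hf.fderiv_right (by simp)
  have hd : DifferentiableAt ℝ (fderiv ℝ f) x := h.differentiable (by simp) x
  have key : ∀ a b : Fin 2, pd a (pd b f) x =
      fderiv ℝ (fderiv ℝ f) x (EuclideanSpace.single a 1) (EuclideanSpace.single b 1) := by
    intro a b
    unfold pd
    rw [fderiv_clm_apply hd (differentiableAt_const _)]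
    simp
  rw [key, key]
  have hs : IsSymmSndFDerivAt ℝ f x :=
    hf.contDiffAt.isSymmSndFDerivAt (by
      rw [minSmoothness_of_isRCLikeNormedField]; exact WithTop.coe_le_coe.2 le_top)
  exact hs _ _

lemma pd_inner {m : ℕ} (k : Fin 2) {f g : E2 → EuclideanSpace ℝ (Fin m)} (x : E2)
    (hf : Differentiable ℝ f) (hg : Differentiable ℝ g) :
    pd k (fun x => inner ℝ (f x) (g x)) x
      = inner ℝ (f x) (pd k g x) + inner ℝ (pd k f x) (g x) := by
  unfold pd
  exact fderiv_inner_apply ℝ (hf x) (hg x) _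

/-- Integration by parts for one term. -/
lemma ibp (k : Fin 2) {P ψ : E2 → ℝ} (hP : ContDiff ℝ 1 P) (hψ : ContDiff ℝ 1 ψ)
    (hs : HasCompactSupport ψ) :
    ∫ x, P x * pd k ψ x = - ∫ x, pd k P x * ψ x := by
  unfold pd
  apply integral_mul_fderiv_eq_neg_fderiv_mul_of_integrable
  · exact ((pd_continuous k hP).mul hψ.continuous).integrable_of_hasCompactSupport hs.mul_left
  · exact (hP.continuous.mul (pd_continuous k hψ)).integrable_of_hasCompactSupport
      (pd_hcs k hs).mul_left
  · exact (hP.continuous.mul hψ.continuous).integrable_of_hasCompactSupport hs.mul_left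
  · exact fun x _ => hP.differentiable (by simp) x
  · exact fun x _ => hψ.differentiable (by simp) x

lemma scaled_tendsto (k : Fin 2) {P ψ : E2 → ℝ} (hPi : Integrable P) (hψ : ContDiff ℝ 1 ψ)
    (hs : HasCompactSupport ψ) :
    Filter.Tendsto (fun m : ℕ => ∫ x, P x * pd k ψ ((1 / ((m : ℝ) + 1)) • x)) Filter.atTop
      (nhds (∫ x, P x * pd k ψ 0)) := by
  have hc := pd_continuous k hψ
  obtain ⟨C, hC⟩ := hc.bounded_above_of_compact_support (pd_hcs k hs)
  apply tendsto_integral_of_dominated_convergence (fun x => ‖P x‖ * C)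
  · intro m
    exact hPi.aestronglyMeasurable.mul
      (hc.comp (continuous_const_smul _)).aestronglyMeasurable
  · exact hPi.norm.mul_const C
  · intro m
    filter_upwards with x
    rw [norm_mul]
    exact mul_le_mul_of_nonneg_left (hC _) (norm_nonneg _)
  · filter_upwards with x
    apply Filter.Tendsto.const_mul
    have h1 : Filter.Tendsto (fun m : ℕ => (1 / ((m : ℝ) + 1)) • x) Filter.atTop
        (nhds ((0 : ℝ) • x)) := tendsto_one_div_add_atTop_nhds_zero_nat.smul_const x
    rw [zero_smul] at h1
    exact (hc.tendsto 0).comp h1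

lemma pd_scale (k : Fin 2) {ψ : E2 → ℝ} (hψ : ContDiff ℝ 1 ψ) (t : ℝ) (x : E2) :
    pd k (fun y => ψ (t • y)) x = t * pd k ψ (t • x) := by
  unfold pd
  have h1 : HasFDerivAt (fun y : E2 => t • y) (t • ContinuousLinearMap.id ℝ E2) x :=
    (hasFDerivAt_id x).const_smul t
  have h2 := ((hψ.differentiable (by simp)) (t • x)).hasFDerivAt.comp x h1
  have h3 := h2.fderiv
  change fderiv ℝ (fun y => ψ (t • y)) x = _ at h3
  rw [h3]
  simp

lemma divfree_aux {P Q ψ : E2 → ℝ} (hP : ContDiff ℝ 1 P) (hQ : ContDiff ℝ 1 Q)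
    (hPi : Integrable P) (hQi : Integrable Q) (hdiv : ∀ x, pd 0 P x + pd 1 Q x = 0)
    (hψ : ContDiff ℝ 1 ψ) (hs : HasCompactSupport ψ) :
    (∫ x, P x) * pd 0 ψ 0 + (∫ x, Q x) * pd 1 ψ 0 = 0 := by
  have h := (scaled_tendsto 0 hPi hψ hs).add (scaled_tendsto 1 hQi hψ hs)
  rw [integral_mul_const, integral_mul_const] at h
  refine tendsto_nhds_unique h ?_
  refine tendsto_const_nhds.congr fun m => ?_
  set t : ℝ := 1 / ((m : ℝ) + 1) with ht
  have htp : t ≠ 0 := by positivity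
  have hψt : ContDiff ℝ 1 (fun y : E2 => ψ (t • y)) := hψ.comp (contDiff_const_smul t)
  have hst : HasCompactSupport (fun y : E2 => ψ (t • y)) := hs.comp_smul htp
  have e0 := ibp 0 hP hψt hst
  have e1 := ibp 1 hQ hψt hst
  simp only [pd_scale _ hψ] at e0 e1
  have hsum : (∫ x, pd 0 P x * ψ (t • x)) + ∫ x, pd 1 Q x * ψ (t • x) = 0 := by
    rw [← integral_add]
    · rw [← integral_zero E2 ℝ]
      congr 1
      ext x
      rw [← add_mul, hdiv, zero_mul]
    · exact ((pd_continuous 0 hP).mul hψt.continuous).integrable_of_hasCompactSupport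
        hst.mul_left
    · exact ((pd_continuous 1 hQ).mul hψt.continuous).integrable_of_hasCompactSupport
        hst.mul_left
  have a0 : ∀ (k : Fin 2) (f : E2 → ℝ), ∫ x, f x * (t * pd k ψ (t • x))
      = t * ∫ x, f x * pd k ψ (t • x) := by
    intro k f
    rw [← integral_const_mul]
    congr 1
    ext x
    ring
  rw [a0] at e0 e1
  have : t * ((∫ x, P x * pd 0 ψ (t • x)) + ∫ x, Q x * pd 1 ψ (t • x)) = 0 := by
    rw [mul_add, e0, e1]; linarith
  exact ((mul_eq_zero.1 this).resolve_left htp).symm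

lemma exists_test (j : Fin 2) : ∃ ψ : E2 → ℝ, ContDiff ℝ 1 ψ ∧ HasCompactSupport ψ ∧
    ∀ k, pd k ψ 0 = if k = j then 1 else 0 := by
  let b : ContDiffBump (0 : E2) := ⟨1, 2, by norm_num, by norm_num⟩
  let L : E2 →L[ℝ] ℝ := EuclideanSpace.proj j
  refine ⟨fun x => b x * L x, b.contDiff.mul L.contDiff, b.hasCompactSupport.mul_right, ?_⟩
  intro k
  have h : (fun x => b x * L x) =ᶠ[nhds 0] L := by
    filter_upwards [b.eventuallyEq_one] with x hx
    rw [hx]; simp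
  unfold pd
  rw [h.fderiv_eq, L.fderiv]
  simp [L, eq_comm]

lemma divfree_left {P Q : E2 → ℝ} (hP : ContDiff ℝ 1 P) (hQ : ContDiff ℝ 1 Q)
    (hPi : Integrable P) (hQi : Integrable Q) (hdiv : ∀ x, pd 0 P x + pd 1 Q x = 0) :
    (∫ x, P x) = 0 ∧ (∫ x, Q x) = 0 := by
  obtain ⟨ψ, h1, h2, h3⟩ := exists_test 0
  obtain ⟨ξ, g1, g2, g3⟩ := exists_test 1
  have e := divfree_aux hP hQ hPi hQi hdiv h1 h2
  have f := divfree_aux hP hQ hPi hQi hdiv g1 g2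
  rw [h3, h3] at e
  rw [g3, g3] at f
  simp at e f
  exact ⟨e, f⟩

/-- Liouville-type theorem — a finite-energy entire solution of
`Δv + c·v(1−|v|²) = 0` on `ℝ²` with `c > 0` is constant (Lemma 2.1 of the paper). -/
theorem ginzburg_landau_entire_finite_energy_constant
    (n : ℕ) (hn : 1 ≤ n) (c : ℝ) (hc : 0 < c)
    (v : E2 → EuclideanSpace ℝ (Fin (n + 1)))
    (hv : ContDiff ℝ (⊤ : ℕ∞) v)
    (heq : ∀ x : E2, lap v x + (c * (1 - ‖v x‖ ^ 2)) • v x = 0)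
    (hint : Integrable (fun x : E2 => gradSqNorm v x + (1 - ‖v x‖ ^ 2) ^ 2)) :
    ∀ x y : E2, v x = v y := by
  have hA : ∀ k, ContDiff ℝ (⊤ : ℕ∞) (pd k v) := fun k => pd_contDiff k hv
  have dv : Differentiable ℝ v := hv.differentiable (by simp)
  have dA : ∀ k, Differentiable ℝ (pd k v) := fun k => (hA k).differentiable (by simp)
  -- scalar ingredients
  let I : Fin 2 → Fin 2 → E2 → ℝ := fun i j x => inner ℝ (pd i v x) (pd j v x)
  let s : E2 → ℝ := fun x => inner ℝ (v x) (v x)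
  have hI : ∀ i j, ContDiff ℝ (⊤ : ℕ∞) (I i j) := fun i j => (hA i).inner ℝ (hA j)
  have hs : ContDiff ℝ (⊤ : ℕ∞) s := hv.inner ℝ hv
  have dI : ∀ i j, Differentiable ℝ (I i j) := fun i j => (hI i j).differentiable (by simp)
  have ds : Differentiable ℝ s := hs.differentiable (by simp)
  have hsn : ∀ x, ‖v x‖ ^ 2 = s x := fun x => (real_inner_self_eq_norm_sq (v x)).symm
  have hIn : ∀ k x, ‖pd k v x‖ ^ 2 = I k k x :=
    fun k x => (real_inner_self_eq_norm_sq (pd k v x)).symm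
  have hIpos : ∀ k x, 0 ≤ I k k x := fun k x => by rw [← hIn]; positivity
  have hint' : Integrable (fun x => I 0 0 x + I 1 1 x + (1 - s x) ^ 2) := by
    refine hint.congr (Filter.Eventually.of_forall fun x => ?_)
    simp only [gradSqNorm, Fin.sum_univ_two, hIn, hsn]
  have cI : ∀ i j, Continuous (I i j) := fun i j => (hI i j).continuous
  have iI : ∀ i j, Integrable (I i j) := by
    intro i j
    refine hint'.mono' (cI i j).aestronglyMeasurable (Filter.Eventually.of_forall fun x => ?_)
    have h1 : ‖I i j x‖ ≤ ‖pd i v x‖ * ‖pd j v x‖ := norm_inner_le_norm _ _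
    have h2 : ∀ k, ‖pd k v x‖ ^ 2 ≤ I 0 0 x + I 1 1 x := by
      intro k
      rw [hIn]
      fin_cases k
      · simpa using hIpos 1 x
      · simpa using hIpos 0 x
    nlinarith [h2 i, h2 j, sq_nonneg (‖pd i v x‖ - ‖pd j v x‖), sq_nonneg (1 - s x)]
  have iW : Integrable (fun x => (1 - s x) ^ 2) := by
    refine hint'.mono' ((continuous_const.sub hs.continuous).pow 2).aestronglyMeasurable (Filter.Eventually.of_forall fun x => ?_)
    rw [Real.norm_of_nonneg (sq_nonneg _)]
    linarith [hIpos 0 x, hIpos 1 x]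
  -- derivative formulas
  have pI : ∀ k i j x, pd k (I i j) x
      = inner ℝ (pd i v x) (pd k (pd j v) x) + inner ℝ (pd k (pd i v) x) (pd j v x) :=
    fun k i j x => pd_inner k x (dA i) (dA j)
  have ps : ∀ k x, pd k s x = 2 * inner ℝ (v x) (pd k v x) := by
    intro k x
    have : pd k s x = _ := pd_inner k x dv dv
    rw [this, real_inner_comm (v x) (pd k v x)]; ring
  have heq' : ∀ x w, inner ℝ (pd 0 (pd 0 v) x) w + inner ℝ (pd 1 (pd 1 v) x) w
      = - (c * (1 - s x)) * inner ℝ (v x) w := by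
    intro x w
    have h := congrArg (fun z => inner ℝ z w) (heq x)
    simp only [lap, inner_add_left, real_inner_smul_left, inner_zero_left, hsn] at h
    linarith
  -- linear combination derivative
  have pcomb : ∀ (k : Fin 2) (σ : ℝ) x,
      pd k (fun x => σ * (I 0 0 x - I 1 1 x) + c / 4 * (1 - s x) ^ 2) x
        = σ * (pd k (I 0 0) x - pd k (I 1 1) x) - c / 2 * (1 - s x) * pd k s x := by
    intro k σ x
    have h0 := (dI 0 0 x).hasFDerivAt
    have h1 := (dI 1 1 x).hasFDerivAt
    have h2 := (ds x).hasFDerivAt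
    have h := ((h0.sub h1).const_mul σ).add (((h2.const_sub 1).pow 2).const_mul (c / 4))
    have h' := h.fderiv
    unfold pd
    change fderiv ℝ (fun x => σ * (I 0 0 x - I 1 1 x) + c / 4 * (1 - s x) ^ 2) x = _ at h'
    rw [h']
    simp
    ring
  have pneg : ∀ k (f : E2 → ℝ) x, pd k (fun x => - f x) x = - pd k f x := by
    intro k f x
    unfold pd
    rw [fderiv_fun_neg]; simp
  have sI : I 1 0 = I 0 1 := by
    ext x; exact real_inner_comm _ _
  have comm := pd_comm hv 0 1
  have hcI : ∀ i j, ContDiff ℝ 1 (I i j) := fun i j => (hI i j).of_le (by simp)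
  have hcs : ContDiff ℝ 1 s := hs.of_le (by simp)
  have iT : ∀ σ : ℝ, Integrable (fun x => σ * (I 0 0 x - I 1 1 x) + c / 4 * (1 - s x) ^ 2) :=
    fun σ => (((iI 0 0).sub (iI 1 1)).const_mul σ).add (iW.const_mul _)
  have cT : ∀ σ : ℝ, ContDiff ℝ 1 (fun x => σ * (I 0 0 x - I 1 1 x) + c / 4 * (1 - s x) ^ 2) := by
    intro σ
    exact (contDiff_const.mul ((hcI 0 0).sub (hcI 1 1))).add
      (contDiff_const.mul ((contDiff_const.sub hcs).pow 2))
  have r0 := (divfree_left (P := fun x => (-1/2) * (I 0 0 x - I 1 1 x) + c / 4 * (1 - s x) ^ 2)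
    (Q := fun x => - I 0 1 x) (cT _) (hcI 0 1).neg (iT _) (iI 0 1).neg (by
      intro x
      rw [pcomb, pneg, pI, pI, pI, ps, comm]
      have := heq' x (pd 0 v x)
      simp only [real_inner_comm (pd 0 v x), real_inner_comm (pd 1 v x)] at *
      simp only [real_inner_comm (v x)] at *
      linarith)).1
  have r1 := (divfree_left (P := fun x => - I 0 1 x)
    (Q := fun x => (1/2) * (I 0 0 x - I 1 1 x) + c / 4 * (1 - s x) ^ 2)
    (hcI 0 1).neg (cT _) (iI 0 1).neg (iT _) (by
      intro x
      rw [pcomb, pneg, pI, pI, pI, ps, comm]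
      have := heq' x (pd 1 v x)
      simp only [real_inner_comm (pd 0 v x), real_inner_comm (pd 1 v x)] at *
      simp only [real_inner_comm (v x)] at *
      linarith)).2
  have hW : ∫ x, (1 - s x) ^ 2 = 0 := by
    have h := integral_add (iT (-1/2)) (iT (1/2))
    rw [r0, r1] at h
    have h2 : ∀ x, ((-1/2) * (I 0 0 x - I 1 1 x) + c / 4 * (1 - s x) ^ 2)
      + ((1/2) * (I 0 0 x - I 1 1 x) + c / 4 * (1 - s x) ^ 2) = c / 2 * (1 - s x) ^ 2 := by
      intro x; ring
    simp only [h2, integral_const_mul] at h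
    have : c / 2 ≠ 0 := by positivity
    simpa [this, hc.ne'] using h
  have hs1 : ∀ x, s x = 1 := by
    have h := (integral_eq_zero_iff_of_nonneg (fun x => sq_nonneg (1 - s x)) iW).1 hW
    have h2 := (Continuous.ae_eq_iff_eq volume
      ((continuous_const.sub hs.continuous).pow 2) continuous_const).1 h
    intro x
    have h3 : (1 - s x) ^ 2 = 0 := congrFun h2 x
    have := pow_eq_zero_iff (two_ne_zero) |>.1 h3
    linarith
  have hsc : s = fun _ => 1 := funext hs1
  have hvk : ∀ k x, inner ℝ (v x) (pd k v x) = 0 := by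
    intro k x
    have h := ps k x
    rw [hsc] at h
    simp [pd] at h
    exact h
  have hkk : ∀ k x, inner ℝ (v x) (pd k (pd k v) x) + I k k x = 0 := by
    intro k x
    have h := pd_inner k x dv (dA k)
    have h2 : (fun x => inner ℝ (v x) (pd k v x)) = fun _ => (0 : ℝ) := funext (hvk k)
    rw [h2] at h
    rw [← h]
    simp [pd]
  have hzero : ∀ k x, pd k v x = 0 := by
    intro k x
    have h0 := hkk 0 x
    have h1 := hkk 1 x
    have h2 := heq' x (v x)
    rw [hs1, real_inner_comm, real_inner_comm (v x) (pd 1 _ x)] at h2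
    have p0 := hIpos 0 x
    have p1 := hIpos 1 x
    have : I k k x = 0 := by
      fin_cases k <;> simp <;> linarith
    exact inner_self_eq_zero.1 this
  have hfd : ∀ x, fderiv ℝ v x = 0 := by
    intro x
    ext1 w
    have hw : w = w 0 • EuclideanSpace.single (0 : Fin 2) (1 : ℝ)
        + w 1 • EuclideanSpace.single (1 : Fin 2) (1 : ℝ) := by
      ext i; fin_cases i <;> simp
    have a := hzero 0 x
    have b := hzero 1 x
    unfold pd at a b
    rw [hw, map_add, map_smul, map_smul, a, b]
    simp
  exact is_const_of_fderiv_eq_zero dv hfd
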